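/- arXiv:2010.04684 — 2 statements merged into one kernel-verified Lean document; each statement's English description precedes it below -/
import Mathlib

section
/- Let w_1, ..., w_n > 0, λ ≥ 0, and let r_1 ≤ r_2 ≤ ... ≤ r_n be nonzero real numbers. If for every index ĩ the condition | sgn(r_ĩ) λ + Σ_{i < ĩ} w_i − Σ_{i > ĩ} w_i | ≤ w_ĩ fails, then λ > | Σ_{i : r_i < 0} w_i − Σ_{i : r_i > 0} w_i |. -/
open Finset

/-- The weight of the indices below `k` minus the weight of the indices from `k` on. -/
def weightBalance {n : ℕ} (w : Fin n → ℝ) (k : ℕ) : ℝ :=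
  (∑ i ∈ univ.filter (fun i : Fin n => i.val < k), w i)
    - ∑ i ∈ univ.filter (fun i : Fin n => k ≤ i.val), w i

theorem weightBalance_val {n : ℕ} (w : Fin n → ℝ) (i : Fin n) :
    weightBalance w i.val = (∑ j ∈ univ.filter (fun j => j < i), w j)
      - (∑ j ∈ univ.filter (fun j => i < j), w j) - w i := by
  have h : univ.filter (fun j : Fin n => i.val ≤ j.val)
      = insert i (univ.filter (fun j => i < j)) := by
    ext j
    simp only [mem_filter, mem_univ, true_and, mem_insert]
    omega
  rw [weightBalance, h, sum_insert (by simp)]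
  simp only [Fin.lt_def]
  ring

theorem weightBalance_val_succ {n : ℕ} (w : Fin n → ℝ) (i : Fin n) :
    weightBalance w (i.val + 1) = (∑ j ∈ univ.filter (fun j => j < i), w j)
      - (∑ j ∈ univ.filter (fun j => i < j), w j) + w i := by
  have h : univ.filter (fun j : Fin n => j.val < i.val + 1)
      = insert i (univ.filter (fun j => j < i)) := by
    ext j
    simp only [mem_filter, mem_univ, true_and, mem_insert]
    omega
  rw [weightBalance, h, sum_insert (by simp)]
  simp only [Fin.lt_def, Nat.succ_le_iff]
  ring

theorem weightBalance_zero {n : ℕ} (w : Fin n → ℝ) : weightBalance w 0 = -∑ i, w i := by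
  simp [weightBalance]

theorem weightBalance_self {n : ℕ} (w : Fin n → ℝ) : weightBalance w n = ∑ i, w i := by
  simp [weightBalance, ← not_lt]

/-- The negative entries of a monotone family without zeros form an initial segment. -/
theorem exists_neg_iff_val_lt {n : ℕ} {r : Fin n → ℝ} (hsort : Monotone r)
    (hr : ∀ i, r i ≠ 0) : ∃ m ≤ n, ∀ i : Fin n, r i < 0 ↔ i.val < m := by
  classical
  have hex : ∃ k, ∀ i : Fin n, k ≤ i.val → 0 < r i :=
    ⟨n, fun i hi => absurd i.isLt (not_lt.mpr hi)⟩
  refine ⟨Nat.find hex, Nat.find_min' hex fun i hi => absurd i.isLt (not_lt.mpr hi),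
    fun i => ⟨fun hi => ?_, fun hi => ?_⟩⟩
  · by_contra! hle
    exact lt_asymm hi (Nat.find_spec hex i hle)
  · have hmin := Nat.find_min hex hi
    push Not at hmin
    obtain ⟨j, hij, hj⟩ := hmin
    exact (hsort (Fin.le_def.mpr hij)).trans_lt (lt_of_le_of_ne hj (hr j))

/-- For positive weights, sorted nonzero values, and `λ ≥ 0`, if
the optimality condition `|sgn(r_itil) λ + Σ_{i < itil} w_i − Σ_{i > itil} w_i| ≤ w_itil`
fails for every index `itil`, then
`λ > |Σ_{i : r_i < 0} w_i − Σ_{i : r_i > 0} w_i|`. -/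
theorem penalty_large_of_no_optimal_index
    (n : ℕ) (hn : 0 < n) (w r : Fin n → ℝ) (hw : ∀ i, 0 < w i)
    (lam : ℝ) (hlam : 0 ≤ lam)
    (hsort : Monotone r) (hr : ∀ i, r i ≠ 0)
    (hcond : ∀ itil : Fin n,
      ¬ (|Real.sign (r itil) * lam
          + (∑ i ∈ univ.filter (fun i => i < itil), w i)
          - (∑ i ∈ univ.filter (fun i => itil < i), w i)| ≤ w itil)) :
    |(∑ i ∈ univ.filter (fun i => r i < 0), w i)
      - (∑ i ∈ univ.filter (fun i => 0 < r i), w i)| < lam := by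
  obtain ⟨m, hmn, hm⟩ := exists_neg_iff_val_lt hsort hr
  have hpos : ∀ i : Fin n, 0 < r i ↔ m ≤ i.val := fun i => by
    rw [← not_lt, ← hm i, not_lt]
    exact ⟨le_of_lt, fun h => lt_of_le_of_ne h (hr i).symm⟩
  have hW : 0 < ∑ i, w i := sum_pos (fun i _ => hw i) ⟨⟨0, hn⟩, mem_univ _⟩
  have hbal : (∑ i ∈ univ.filter (fun i => r i < 0), w i)
      - (∑ i ∈ univ.filter (fun i => 0 < r i), w i) = weightBalance w m := by
    simp only [weightBalance, hm, hpos]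
  have hupper : ∀ k ≤ m, weightBalance w k < lam := by
    intro k
    induction k with
    | zero => intro _; rw [weightBalance_zero]; linarith
    | succ k ih =>
      intro hk
      have hlt := ih (by omega)
      have hc := hcond ⟨k, by omega⟩
      have h0 := weightBalance_val w ⟨k, by omega⟩
      have h1 := weightBalance_val_succ w ⟨k, by omega⟩
      rw [Real.sign_of_neg ((hm ⟨k, by omega⟩).mpr hk), abs_le] at hc
      dsimp only at h0 h1
      by_contra! hge
      exact hc ⟨by linarith, by linarith⟩
  have hlower : ∀ d k, k + d = n → m ≤ k → -lam < weightBalance w k := by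
    intro d
    induction d with
    | zero =>
      intro k hk _
      obtain rfl : k = n := by omega
      rw [weightBalance_self]
      linarith
    | succ d ih =>
      intro k hk hmk
      have hlt := ih (k + 1) (by omega) (by omega)
      have hc := hcond ⟨k, by omega⟩
      have h0 := weightBalance_val w ⟨k, by omega⟩
      have h1 := weightBalance_val_succ w ⟨k, by omega⟩
      rw [Real.sign_of_pos ((hpos ⟨k, by omega⟩).mpr hmk), abs_le] at hc
      dsimp only at h0 h1
      by_contra! hge
      exact hc ⟨by linarith, by linarith⟩
  rw [hbal, abs_lt]
  exact ⟨hlower (n - m) m (by omega) le_rfl, hupper m le_rfl⟩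
end

section
/- Let x_1, ..., x_n ∈ R^m and fix a coordinate ĵ ∈ {1,...,m}. Then there exists a finite set V ⊆ {v ∈ R^m : v_ĵ = 1} such that for every λ ≥ 0, z_ĵ(λ) = min over v ∈ V of ( Σ_{i=1}^n Σ_{j=1}^m |x_{ij} − v_j x_{iĵ}| + λ Σ_{j=1}^m |v_j| ); in particular, λ ↦ z_ĵ(λ) is piecewise linear on [0, ∞) with finitely many breakpoints. One may take V to be the set of vectors whose j-th coordinate lies in {0} ∪ {x_{ij}/x_{iĵ} : i with x_{iĵ} ≠ 0} for each j ≠ ĵ. -/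
/-- A sum of absolute values of affine functions of one real variable is minimized over any
nonempty finite set containing all the breakpoints. -/
theorem exists_mem_sum_abs_sub_mul_le {ι : Type*} [Fintype ι] (a b : ι → ℝ) (P : Finset ℝ)
    (hP : P.Nonempty) (hab : ∀ i, b i ≠ 0 → a i / b i ∈ P) (t : ℝ) :
    ∃ p ∈ P, ∑ i, |a i - p * b i| ≤ ∑ i, |a i - t * b i| := by
  have hfactor : ∀ i, b i ≠ 0 → ∀ s, |a i - s * b i| = |a i / b i - s| * |b i| := by
    intro i hi s
    rw [← abs_mul, sub_mul, div_mul_cancel₀ _ hi]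
  rcases (P.filter (· ≤ t)).eq_empty_or_nonempty with hL | hL
  · refine ⟨P.min' hP, P.min'_mem hP, Finset.sum_le_sum fun i _ => ?_⟩
    by_cases hi : b i = 0
    · simp [hi]
    rw [hfactor i hi, hfactor i hi]
    have hmin := P.min'_le _ (hab i hi)
    have ht : t < P.min' hP := by
      simpa using Finset.filter_eq_empty_iff.1 hL (P.min'_mem hP)
    gcongr ?_ * _
    rw [abs_of_nonneg (by linarith), abs_of_nonneg (by linarith)]
    linarith
  rcases (P.filter (t ≤ ·)).eq_empty_or_nonempty with hU | hU
  · refine ⟨P.max' hP, P.max'_mem hP, Finset.sum_le_sum fun i _ => ?_⟩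
    by_cases hi : b i = 0
    · simp [hi]
    rw [hfactor i hi, hfactor i hi]
    have hmax := P.le_max' _ (hab i hi)
    have ht : P.max' hP < t := by
      simpa using Finset.filter_eq_empty_iff.1 hU (P.max'_mem hP)
    gcongr ?_ * _
    rw [abs_of_nonpos (by linarith), abs_of_nonpos (by linarith)]
    linarith
  obtain ⟨hlP, hlt⟩ := Finset.mem_filter.1 ((P.filter (· ≤ t)).max'_mem hL)
  obtain ⟨huP, htu⟩ := Finset.mem_filter.1 ((P.filter (t ≤ ·)).min'_mem hU)
  have hgap : ∀ p ∈ P, p ≤ (P.filter (· ≤ t)).max' hL ∨ (P.filter (t ≤ ·)).min' hU ≤ p := by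
    intro p hp
    rcases le_total p t with h | h
    · exact .inl (Finset.le_max' _ _ (Finset.mem_filter.2 ⟨hp, h⟩))
    · exact .inr (Finset.min'_le _ _ (Finset.mem_filter.2 ⟨hp, h⟩))
  generalize (P.filter (· ≤ t)).max' hL = l at *
  generalize (P.filter (t ≤ ·)).min' hU = u at *
  obtain ⟨α, β, hα, hβ, hαβ, rfl⟩ : t ∈ segment ℝ l u := by
    rw [segment_eq_Icc (hlt.trans htu)]
    exact ⟨hlt, htu⟩
  simp only [smul_eq_mul] at *
  have hconcave : α * ∑ i, |a i - l * b i| + β * ∑ i, |a i - u * b i|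
      ≤ ∑ i, |a i - (α * l + β * u) * b i| := by
    rw [Finset.mul_sum, Finset.mul_sum, ← Finset.sum_add_distrib]
    refine Finset.sum_le_sum fun i _ => ?_
    by_cases hi : b i = 0
    · simp [hi, ← add_mul, hαβ]
    simp only [hfactor i hi]
    rw [← mul_assoc, ← mul_assoc, ← add_mul]
    gcongr ?_ * _
    obtain rfl : β = 1 - α := by linarith
    rcases hgap _ (hab i hi) with h | h
    · rw [abs_of_nonpos (by linarith), abs_of_nonpos (by linarith), abs_of_nonpos (by linarith)]
      linarith
    · rw [abs_of_nonneg (by linarith), abs_of_nonneg (by linarith), abs_of_nonneg (by linarith)]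
      linarith
  by_contra! hlarge
  have hl := hlarge l hlP
  have hu := hlarge u huP
  obtain rfl : β = 1 - α := by linarith
  nlinarith [mul_le_mul_of_nonneg_left hl.le hα, mul_le_mul_of_nonneg_left hu.le hβ]

/-- There is a finite set `V` of vectors with `v_jhat = 1`, whose
coordinates `j ≠ jhat` lie in `{0} ∪ {x_{ij}/x_{ijhat} : x_{ijhat} ≠ 0}`, such that for
every `λ ≥ 0` the optimal value `z_jhat(λ)` equals the minimum over `v ∈ V` of
the objective; in particular `λ ↦ z_jhat(λ)` is piecewise linear with finitely
many breakpoints. -/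
theorem optimal_value_is_finite_min_of_affine
    (n m : ℕ) (x : Fin n → Fin m → ℝ) (jhat : Fin m) :
    ∃ (V : Finset (Fin m → ℝ)) (hV : V.Nonempty),
      (∀ v ∈ V, v jhat = 1) ∧
      (∀ v ∈ V, ∀ j, j ≠ jhat → v j = 0 ∨ ∃ i, x i jhat ≠ 0 ∧ v j = x i j / x i jhat) ∧
      ∀ lam : ℝ, 0 ≤ lam →
        sInf {c : ℝ | ∃ v : Fin m → ℝ, v jhat = 1 ∧
            c = (∑ i, ∑ j, |x i j - v j * x i jhat|) + lam * ∑ j, |v j|}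
        = V.inf' hV
            (fun v => (∑ i, ∑ j, |x i j - v j * x i jhat|) + lam * ∑ j, |v j|) := by
  classical
  let S : Fin m → Finset ℝ := fun j =>
    insert 0 ((Finset.univ.filter fun i => x i jhat ≠ 0).image fun i => x i j / x i jhat)
  let T : Fin m → Finset ℝ := fun j => if j = jhat then {1} else S j
  have hTjhat : T jhat = {1} := if_pos rfl
  have hT : ∀ j, j ≠ jhat → T j = S j := fun j hj => if_neg hj
  have hV : (Fintype.piFinset T).Nonempty := by
    refine Fintype.piFinset_nonempty.2 fun j => ?_
    by_cases hj : j = jhat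
    · subst hj; simp [hTjhat]
    · rw [hT j hj]; exact Finset.insert_nonempty _ _
  have hfeasible : ∀ v ∈ Fintype.piFinset T, v jhat = 1 := fun v hv => by
    simpa [hTjhat] using Fintype.mem_piFinset.1 hv jhat
  refine ⟨Fintype.piFinset T, hV, hfeasible, ?_, ?_⟩
  · intro v hv j hj
    have h := Fintype.mem_piFinset.1 hv j
    rw [hT j hj] at h
    simp only [S, Finset.mem_insert, Finset.mem_image, Finset.mem_filter, Finset.mem_univ,
      true_and] at h
    exact h.imp_right fun ⟨i, hi, h⟩ => ⟨i, hi, h.symm⟩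
  intro lam hlam
  refine IsLeast.csInf_eq ⟨?_, ?_⟩
  · obtain ⟨v, hv, h⟩ := Finset.exists_mem_eq_inf' hV
      (fun v : Fin m → ℝ => (∑ i, ∑ j, |x i j - v j * x i jhat|) + lam * ∑ j, |v j|)
    exact ⟨v, hfeasible v hv, h⟩
  rintro c ⟨v, hv, rfl⟩
  have hcoord : ∀ j, ∃ p ∈ T j, (∑ i, |x i j - p * x i jhat|) + lam * |p|
      ≤ (∑ i, |x i j - v j * x i jhat|) + lam * |v j| := by
    intro j
    by_cases hj : j = jhat
    · subst hj
      exact ⟨v j, by simp [hTjhat, hv], le_rfl⟩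
    rw [hT j hj]
    obtain ⟨p, hp, h⟩ := exists_mem_sum_abs_sub_mul_le
      (fun o : Option (Fin n) => o.elim 0 fun i => x i j)
      (fun o => o.elim lam fun i => x i jhat) (S j) (Finset.insert_nonempty _ _)
      (by
        rintro (_ | i) hi
        · simp [S]
        · exact Finset.mem_insert_of_mem
            (Finset.mem_image_of_mem _ (Finset.mem_filter.2 ⟨Finset.mem_univ i, hi⟩)))
      (v j)
    refine ⟨p, hp, ?_⟩
    simpa [Fintype.sum_option, abs_mul, abs_of_nonneg hlam, mul_comm, add_comm] using h
  choose w hw hle using hcoord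
  refine (Finset.inf'_le _ (Fintype.mem_piFinset.2 hw)).trans ?_
  have hseparable : ∀ y : Fin m → ℝ, (∑ i, ∑ j, |x i j - y j * x i jhat|) + lam * ∑ j, |y j|
      = ∑ j, ((∑ i, |x i j - y j * x i jhat|) + lam * |y j|) := fun y => by
    rw [Finset.sum_comm, Finset.mul_sum, Finset.sum_add_distrib]
  rw [hseparable, hseparable]
  exact Finset.sum_le_sum fun j _ => hle j
end
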